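/- Let θ = α(d + β − 2α)/(β − α). Then there exists a constant C > 0 such that for every u ∈ C_c^∞(ℝ^d): ( ∫_{ℝ^d} u² dμ )^{(θ+α)/θ} ≤ C·D(u,u)·( ∫_{ℝ^d} |u(x)|·(1 + |x|)^{α−d} μ(dx) )^{2α/θ}. -/

import Mathlib

open MeasureTheory

/-- The fractional Dirichlet energy
`D(f,f) = ∫∫ (f(x) − f(y))² / |x − y|^{d+α} dx dy` on `ℝ^d`. -/
noncomputable def fracD (d : ℕ) (α : ℝ) (f : EuclideanSpace ℝ (Fin d) → ℝ) : ℝ :=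
  ∫ x, ∫ y, (f x - f y) ^ 2 / ‖x - y‖ ^ ((d : ℝ) + α)


open Set Metric

lemma phi_integrable (d : ℕ) (α : ℝ) (hα : α ∈ Set.Ioo (0 : ℝ) 2) (hd : 0 < d) :
    Integrable (fun z : EuclideanSpace ℝ (Fin d) => min (‖z‖ ^ 2) 1 / ‖z‖ ^ ((d : ℝ) + α)) := by
  have hne : Nonempty (Fin d) := ⟨⟨0, hd⟩⟩
  have hnt : Nontrivial (EuclideanSpace ℝ (Fin d)) := inferInstance
  have key := (integrable_fun_norm_addHaar (volume : Measure (EuclideanSpace ℝ (Fin d)))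
    (f := fun y : ℝ => min (y ^ 2) 1 / y ^ ((d : ℝ) + α))).2
  apply key
  rw [finrank_euclideanSpace_fin]
  have hsplit : Ioi (0 : ℝ) = Ioo 0 1 ∪ Ici 1 := by
    ext x; simp only [mem_Ioi, mem_union, mem_Ioo, mem_Ici]
    constructor
    · intro h; rcases lt_or_ge x 1 with h1 | h1
      · exact Or.inl ⟨h, h1⟩
      · exact Or.inr h1
    · rintro (h | h) <;> linarith [h]
  have hpow : ∀ y : ℝ, 0 < y → y ^ (d - 1) = y ^ ((d : ℝ) - 1) := by
    intro y hy
    rw [← Real.rpow_natCast y (d - 1), Nat.cast_sub hd]; simp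
  rw [hsplit]
  apply IntegrableOn.union
  · have h1 : IntegrableOn (fun y : ℝ => y ^ (1 - α)) (Ioo 0 1) := by
      rw [intervalIntegral.integrableOn_Ioo_rpow_iff one_pos]; linarith [hα.2]
    refine h1.congr_fun ?_ measurableSet_Ioo
    intro y hy
    have hy0 := hy.1
    have : y ^ 2 ≤ 1 := by nlinarith [hy.1, hy.2]
    simp only [smul_eq_mul, min_eq_left this]
    rw [hpow y hy0, ← Real.rpow_natCast y 2, ← Real.rpow_sub hy0, ← Real.rpow_add hy0]
    congr 1; push_cast; ring
  · rw [integrableOn_Ici_iff_integrableOn_Ioi]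
    have h1 : IntegrableOn (fun y : ℝ => y ^ (-1 - α)) (Ioi 1) :=
      integrableOn_Ioi_rpow_of_lt (by linarith [hα.1]) one_pos
    refine h1.congr_fun ?_ measurableSet_Ioi
    intro y hy
    have hy1 : 1 < y := hy
    have hy0 : 0 < y := by linarith
    have : 1 ≤ y ^ 2 := by nlinarith
    simp only [smul_eq_mul, min_eq_right this]
    rw [hpow y hy0, one_div, ← Real.rpow_neg hy0.le, ← Real.rpow_add hy0]
    congr 1; ring

lemma u_bound (d : ℕ) (u : EuclideanSpace ℝ (Fin d) → ℝ)
    (hu : ContDiff ℝ (⊤ : ℕ∞) u) (hc : HasCompactSupport u) :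
    ∃ A : ℝ, 0 ≤ A ∧ ∀ x y, (u x - u y) ^ 2 ≤ A * min (‖x - y‖ ^ 2) 1 := by
  obtain ⟨L, hL⟩ := hu.lipschitzWith_of_hasCompactSupport hc (by simp)
  obtain ⟨B, hB⟩ := hc.exists_bound_of_continuous hu.continuous
  refine ⟨(L : ℝ) ^ 2 + 4 * B ^ 2, by positivity, fun x y => ?_⟩
  have h1 : |u x - u y| ≤ L * ‖x - y‖ := by
    have := hL.dist_le_mul x y
    rwa [Real.dist_eq, dist_eq_norm] at this
  have h2 : |u x - u y| ≤ 2 * B := by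
    have := hB x; have := hB y; rw [Real.norm_eq_abs] at *
    have := abs_sub (u x) (u y); linarith
  rw [← sq_abs]
  have h3 : |u x - u y| ^ 2 ≤ (L * ‖x - y‖) ^ 2 := by gcongr
  have h4 : |u x - u y| ^ 2 ≤ (2 * B) ^ 2 := by gcongr
  rcases min_choice (‖x - y‖ ^ 2) 1 with h | h <;> rw [h]
  · nlinarith [mul_nonneg (sq_nonneg B) (sq_nonneg ‖x - y‖)]
  · nlinarith [sq_nonneg (L : ℝ)]

lemma kernel_meas (d : ℕ) (α : ℝ) (u : EuclideanSpace ℝ (Fin d) → ℝ) (hu : Continuous u) :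
    Measurable (fun p : EuclideanSpace ℝ (Fin d) × EuclideanSpace ℝ (Fin d) =>
      (u p.1 - u p.2) ^ 2 / ‖p.1 - p.2‖ ^ ((d : ℝ) + α)) := by
  have := hu.measurable
  fun_prop

lemma kernel_inner (d : ℕ) (α : ℝ) (hα : α ∈ Set.Ioo (0 : ℝ) 2) (hd : 0 < d)
    (u : EuclideanSpace ℝ (Fin d) → ℝ)
    (hu : ContDiff ℝ (⊤ : ℕ∞) u) (hc : HasCompactSupport u) (x : EuclideanSpace ℝ (Fin d)) :
    Integrable (fun y => (u x - u y) ^ 2 / ‖x - y‖ ^ ((d : ℝ) + α)) := by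
  obtain ⟨A, hA, h⟩ := u_bound d u hu hc
  have hi := ((phi_integrable d α hα hd).comp_sub_left x).const_mul A
  refine hi.mono' ?_ ?_
  · exact ((kernel_meas d α u hu.continuous).comp (measurable_prodMk_left (x := x))).aestronglyMeasurable
  · filter_upwards with y
    rw [Real.norm_eq_abs, abs_of_nonneg (by positivity), ← mul_div_assoc]
    gcongr; exact h x y

lemma kernel_prod (d : ℕ) (α : ℝ) (hα : α ∈ Set.Ioo (0 : ℝ) 2) (hd : 0 < d)
    (u : EuclideanSpace ℝ (Fin d) → ℝ)
    (hu : ContDiff ℝ (⊤ : ℕ∞) u) (hc : HasCompactSupport u) :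
    Integrable (fun p : EuclideanSpace ℝ (Fin d) × EuclideanSpace ℝ (Fin d) =>
      (u p.1 - u p.2) ^ 2 / ‖p.1 - p.2‖ ^ ((d : ℝ) + α)) (volume.prod volume) := by
  obtain ⟨A, hA, h⟩ := u_bound d u hu hc
  set K := tsupport u
  have hK : IsCompact K := hc
  have hKi : Integrable (K.indicator (fun _ => (1 : ℝ))) (volume : Measure (EuclideanSpace ℝ (Fin d))) :=
    (integrable_indicator_iff hK.measurableSet).2 (integrableOn_const hK.measure_lt_top.ne)
  have hi := Integrable.convolution_integrand (ContinuousLinearMap.mul ℝ ℝ) hKi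
    (phi_integrable d α hα hd)
  have hi' := hi.swap
  refine ((hi.add hi').const_mul A).mono' (kernel_meas d α u hu.continuous).aestronglyMeasurable ?_
  filter_upwards with p
  obtain ⟨x, y⟩ := p
  simp only [Function.comp, Pi.add_apply, Prod.swap, ContinuousLinearMap.mul_apply']
  rw [Real.norm_eq_abs, abs_of_nonneg (by positivity), norm_sub_rev y x, ← add_mul]
  have hφ : 0 ≤ min (‖x - y‖ ^ 2) 1 / ‖x - y‖ ^ ((d : ℝ) + α) := by positivity
  have n0 : ∀ z, 0 ≤ K.indicator (fun _ => (1 : ℝ)) z := fun z => indicator_nonneg (by simp) z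
  by_cases hx : x ∈ K ∨ y ∈ K
  · have h1 : 1 ≤ K.indicator (fun _ => (1 : ℝ)) y + K.indicator (fun _ => (1 : ℝ)) x := by
      rcases hx with hx | hx
      · have := n0 y; simp only [indicator_of_mem hx]; linarith
      · have := n0 x; simp only [indicator_of_mem hx]; linarith
    calc _ ≤ A * (min (‖x - y‖ ^ 2) 1 / ‖x - y‖ ^ ((d : ℝ) + α)) := by
          rw [← mul_div_assoc]; gcongr; exact h x y
      _ ≤ _ := by
          gcongr
          exact le_mul_of_one_le_left hφ h1
  · push Not at hx
    rw [image_eq_zero_of_notMem_tsupport hx.1, image_eq_zero_of_notMem_tsupport hx.2]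
    have := n0 x; have := n0 y
    simp only [sub_self]
    norm_num
    positivity

lemma ball_vol (d : ℕ) (x : EuclideanSpace ℝ (Fin d)) {r : ℝ} (hr : 0 < r) :
    volume.real (ball x r) = r ^ d * volume.real (ball (0 : EuclideanSpace ℝ (Fin d)) 1) := by
  rw [Measure.real, Measure.addHaar_ball_of_pos _ x hr, ENNReal.toReal_mul,
    ENNReal.toReal_ofReal (by positivity), finrank_euclideanSpace_fin, Measure.real]

lemma final_step (α θ C I D M : ℝ) (hα : 0 < α) (hθ : 0 < θ) (hC : 0 < C)
    (hI : 0 ≤ I) (hD : 0 ≤ D) (hM : 0 ≤ M)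
    (h : ∀ t : ℝ, 0 < t → I ≤ C * (t * D + t ^ (-(θ / α)) * M ^ 2)) :
    I ^ ((θ + α) / θ) ≤ (2 * C * (2 * C) ^ (α / θ)) * D * M ^ (2 * α / θ) := by
  rcases hI.eq_or_lt with rfl | hI
  · rw [Real.zero_rpow (by positivity)]; positivity
  rcases hM.eq_or_lt with rfl | hM
  · exfalso
    have := h (I / (2 * C * (D + 1))) (by positivity)
    have h2 : C * (I / (2 * C * (D + 1)) * D + (I / (2 * C * (D + 1))) ^ (-(θ / α)) * 0 ^ 2)
      = I / 2 * (D / (D + 1)) := by field_simp; ring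
    rw [h2] at this
    have : D / (D + 1) ≤ 1 := by rw [div_le_one (by positivity)]; linarith
    nlinarith
  have hX : 0 < 2 * C * M ^ 2 / I := by positivity
  have := h ((2 * C * M ^ 2 / I) ^ (α / θ)) (by positivity)
  rw [← Real.rpow_mul hX.le] at this
  have he : α / θ * -(θ / α) = -1 := by field_simp
  rw [he, Real.rpow_neg_one] at this
  have h2 : C * ((2 * C * M ^ 2 / I)⁻¹ * M ^ 2) = I / 2 := by field_simp
  have h3 : I ≤ 2 * C * (2 * C * M ^ 2 / I) ^ (α / θ) * D := by linarith
  have e1 : (θ + α) / θ = 1 + α / θ := by field_simp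
  have e2 : M ^ (2 * α / θ) = (M ^ 2) ^ (α / θ) := by
    rw [← Real.rpow_natCast M 2, ← Real.rpow_mul hM.le]; congr 1; push_cast; ring
  rw [e1, e2, Real.rpow_add hI, Real.rpow_one]
  rw [Real.div_rpow (by positivity) hI.le, Real.mul_rpow (by positivity) (by positivity)] at h3
  have hIp : 0 < I ^ (α / θ) := by positivity
  calc I * I ^ (α / θ) ≤ (2 * C * ((2 * C) ^ (α / θ) * (M ^ 2) ^ (α / θ) / I ^ (α / θ)) * D) * I ^ (α / θ) := by gcongr
    _ = _ := by field_simp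

lemma weight_cont (d : ℕ) (s : ℝ) :
    Continuous (fun x : EuclideanSpace ℝ (Fin d) => (1 + ‖x‖) ^ s) := by
  refine Continuous.rpow_const (by fun_prop) (fun x => Or.inl ?_)
  positivity

lemma sq_weight_int (d : ℕ) (s : ℝ) (u : EuclideanSpace ℝ (Fin d) → ℝ)
    (hu : Continuous u) (hc : HasCompactSupport u) :
    Integrable (fun x => (u x) ^ 2 * (1 + ‖x‖) ^ s) := by
  apply Continuous.integrable_of_hasCompactSupport
  · exact (hu.pow 2).mul (weight_cont d s)
  · exact (hc.comp_left (g := fun z : ℝ => z ^ 2) (by simp)).mul_right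

lemma abs_weight_int (d : ℕ) (s : ℝ) (u : EuclideanSpace ℝ (Fin d) → ℝ)
    (hu : Continuous u) (hc : HasCompactSupport u) :
    Integrable (fun x => |u x| * (1 + ‖x‖) ^ s) := by
  apply Continuous.integrable_of_hasCompactSupport
  · exact hu.abs.mul (weight_cont d s)
  · exact (hc.comp_left (g := fun z : ℝ => |z|) (by simp)).mul_right

lemma avg_kernel (d : ℕ) (α : ℝ) (hα : α ∈ Set.Ioo (0 : ℝ) 2) (hd : 0 < d)
    (u : EuclideanSpace ℝ (Fin d) → ℝ)
    (hu : ContDiff ℝ (⊤ : ℕ∞) u) (hc : HasCompactSupport u) (x : EuclideanSpace ℝ (Fin d))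
    (S : Set (EuclideanSpace ℝ (Fin d))) (hS : MeasurableSet S) (ρ : ℝ) (hρ : 0 < ρ)
    (hSρ : ∀ y ∈ S, ‖x - y‖ ≤ ρ) :
    ∫ y in S, (u x - u y) ^ 2 ≤
      ρ ^ ((d : ℝ) + α) * ∫ y, (u x - u y) ^ 2 / ‖x - y‖ ^ ((d : ℝ) + α) := by
  have hk := kernel_inner d α hα hd u hu hc x
  have hα0 := hα.1
  have hp : 0 < (d : ℝ) + α := by positivity
  have hpt : ∀ y ∈ S, (u x - u y) ^ 2 ≤
      ρ ^ ((d : ℝ) + α) * ((u x - u y) ^ 2 / ‖x - y‖ ^ ((d : ℝ) + α)) := by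
    intro y hy
    by_cases hxy : x = y
    · subst hxy; simp
    · have h0 : 0 < ‖x - y‖ := norm_pos_iff.2 (sub_ne_zero.2 hxy)
      have h1 : ‖x - y‖ ^ ((d : ℝ) + α) ≤ ρ ^ ((d : ℝ) + α) :=
        Real.rpow_le_rpow h0.le (hSρ y hy) hp.le
      have h2 : 0 < ‖x - y‖ ^ ((d : ℝ) + α) := by positivity
      rw [mul_div_assoc', le_div_iff₀ h2, mul_comm]
      gcongr
  calc ∫ y in S, (u x - u y) ^ 2
      ≤ ∫ y in S, ρ ^ ((d : ℝ) + α) * ((u x - u y) ^ 2 / ‖x - y‖ ^ ((d : ℝ) + α)) := by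
        refine integral_mono_of_nonneg (ae_of_all _ fun y => by positivity)
          (hk.const_mul _).integrableOn ?_
        exact (ae_restrict_mem hS).mono hpt
    _ ≤ ∫ y, ρ ^ ((d : ℝ) + α) * ((u x - u y) ^ 2 / ‖x - y‖ ^ ((d : ℝ) + α)) :=
        setIntegral_le_integral (hk.const_mul _) (ae_of_all _ fun y => by positivity)
    _ = _ := integral_const_mul _ _

lemma sq_le_avg (d : ℕ) (α : ℝ) (hα : α ∈ Set.Ioo (0 : ℝ) 2) (hd : 0 < d)
    (u : EuclideanSpace ℝ (Fin d) → ℝ)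
    (hu : ContDiff ℝ (⊤ : ℕ∞) u) (hc : HasCompactSupport u) (x : EuclideanSpace ℝ (Fin d))
    (S : Set (EuclideanSpace ℝ (Fin d))) (hS : MeasurableSet S) (hS' : volume S ≠ ⊤)
    (ρ : ℝ) (hρ : 0 < ρ) (hSρ : ∀ y ∈ S, ‖x - y‖ ≤ ρ) :
    volume.real S * (u x) ^ 2 ≤
      2 * (ρ ^ ((d : ℝ) + α) * ∫ y, (u x - u y) ^ 2 / ‖x - y‖ ^ ((d : ℝ) + α))
        + 2 * ∫ y in S, (u y) ^ 2 ∧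
    volume.real S * (u x) ^ 2 ≤
      (ρ ^ ((d : ℝ) + α) * ∫ y, (u x - u y) ^ 2 / ‖x - y‖ ^ ((d : ℝ) + α))
        + 2 * |u x| * ∫ y in S, |u y| := by
  have hk := avg_kernel d α hα hd u hu hc x S hS ρ hρ hSρ
  have hcst : ∀ c : ℝ, IntegrableOn (fun _ : EuclideanSpace ℝ (Fin d) => c) S :=
    fun c => integrableOn_const hS'
  have hui : Integrable u := hu.continuous.integrable_of_hasCompactSupport hc
  have hu2 : Integrable (fun y => u y ^ 2) := by
    simpa using sq_weight_int d 0 u hu.continuous hc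
  have hdi : IntegrableOn (fun y => (u x - u y) ^ 2) S := by
    have : IntegrableOn (fun y => u x ^ 2 - 2 * u x * u y + u y ^ 2) S :=
      ((hcst (u x ^ 2)).sub (hui.const_mul (2 * u x)).integrableOn).add hu2.integrableOn
    refine this.congr_fun (fun y _ => ?_) hS
    simp only; ring
  have hl : volume.real S * (u x) ^ 2 = ∫ y in S, (u x) ^ 2 := by
    rw [setIntegral_const, smul_eq_mul]
  constructor
  · calc volume.real S * (u x) ^ 2 = ∫ y in S, (u x) ^ 2 := hl
      _ ≤ ∫ y in S, (2 * (u x - u y) ^ 2 + 2 * (u y) ^ 2) := by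
        refine integral_mono (hcst _) ((hdi.const_mul 2).add (hu2.const_mul 2).integrableOn) ?_
        intro y; simp only; nlinarith [sq_nonneg (u x - 2 * u y)]
      _ = 2 * (∫ y in S, (u x - u y) ^ 2) + 2 * ∫ y in S, (u y) ^ 2 := by
        rw [integral_add (hdi.const_mul 2) (hu2.const_mul 2).integrableOn, integral_const_mul,
          integral_const_mul]
      _ ≤ _ := by gcongr
  · calc volume.real S * (u x) ^ 2 = ∫ y in S, (u x) ^ 2 := hl
      _ ≤ ∫ y in S, ((u x - u y) ^ 2 + 2 * |u x| * |u y|) := by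
        refine integral_mono (hcst _) (hdi.add (hui.abs.const_mul _).integrableOn) ?_
        intro y; simp only
        have h1 : u x * u y ≤ |u x| * |u y| := by rw [← abs_mul]; exact le_abs_self _
        nlinarith [sq_nonneg (u y)]
      _ = (∫ y in S, (u x - u y) ^ 2) + 2 * |u x| * ∫ y in S, |u y| := by
        rw [integral_add hdi (hui.abs.const_mul _).integrableOn, integral_const_mul]
      _ ≤ _ := by gcongr

lemma hardy_pt (d : ℕ) (α : ℝ) (hα : α ∈ Set.Ioo (0 : ℝ) 2) (hd : 0 < d)
    (u : EuclideanSpace ℝ (Fin d) → ℝ)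
    (hu : ContDiff ℝ (⊤ : ℕ∞) u) (hc : HasCompactSupport u) (lam : ℝ) (hl : 1 ≤ lam) (V : ℝ)
    (hV : V = volume.real (ball (0 : EuclideanSpace ℝ (Fin d)) 1)) (hV0 : 0 < V)
    (x : EuclideanSpace ℝ (Fin d)) :
    (u x) ^ 2 * (1 + ‖x‖) ^ (-α) ≤
      (2 * 3 ^ ((d : ℝ) + α) * lam ^ α / V) *
          (∫ y, (u x - u y) ^ 2 / ‖x - y‖ ^ ((d : ℝ) + α)) +
      ∫ y, (2 / (V * lam ^ d) * (1 + ‖x‖) ^ (-α - d)) *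
        {p : EuclideanSpace ℝ (Fin d) × EuclideanSpace ℝ (Fin d) |
          lam * (1 + ‖p.1‖) ≤ ‖p.2‖ ∧ ‖p.2‖ < 2 * (lam * (1 + ‖p.1‖))}.indicator
          (fun p => (u p.2) ^ 2) (x, y) := by
  set w := 1 + ‖x‖ with hw
  have hx0 := norm_nonneg x
  have hw1 : 1 ≤ w := by linarith
  have hw0 : 0 < w := by linarith
  have hl0 : 0 < lam := by linarith
  have hlw : 0 < lam * w := by positivity
  set S := ball (0 : EuclideanSpace ℝ (Fin d)) (2 * (lam * w)) \ ball 0 (lam * w) with hSdef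
  have hS : MeasurableSet S := measurableSet_ball.diff measurableSet_ball
  have hS' : volume S ≠ ⊤ := measure_ne_top_of_subset sdiff_subset measure_ball_lt_top.ne
  have hvol : (lam * w) ^ d * V ≤ volume.real S := by
    rw [hSdef, measureReal_sdiff (ball_subset_ball (by linarith)) measurableSet_ball
      measure_ball_lt_top.ne,
      ball_vol d _ (by positivity), ball_vol d _ hlw, ← hV, mul_pow 2]
    have h2 : (2 : ℝ) ≤ 2 ^ d := by
      calc (2 : ℝ) = 2 ^ 1 := by norm_num
        _ ≤ 2 ^ d := pow_le_pow_right₀ (by norm_num) hd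
    have : 0 ≤ (lam * w) ^ d * V := by positivity
    nlinarith
  have h1 := (sq_le_avg d α hα hd u hu hc x S hS hS' (3 * (lam * w)) (by positivity) (by
    intro y hy
    have : ‖y‖ < 2 * (lam * w) := by simpa using hy.1
    have h3 : w ≤ lam * w := le_mul_of_one_le_left hw0.le hl
    have := norm_sub_le x y
    linarith)).1
  set G := ∫ y, (u x - u y) ^ 2 / ‖x - y‖ ^ ((d : ℝ) + α) with hG
  have hint : (∫ y, (2 / (V * lam ^ d) * w ^ (-α - d)) *
        {p : EuclideanSpace ℝ (Fin d) × EuclideanSpace ℝ (Fin d) |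
          lam * (1 + ‖p.1‖) ≤ ‖p.2‖ ∧ ‖p.2‖ < 2 * (lam * (1 + ‖p.1‖))}.indicator
          (fun p => (u p.2) ^ 2) (x, y)) =
      (2 / (V * lam ^ d) * w ^ (-α - d)) * ∫ y in S, (u y) ^ 2 := by
    rw [integral_const_mul, ← integral_indicator hS]
    congr 2
    ext y
    have : (y ∈ S) ↔ (lam * (1 + ‖x‖) ≤ ‖y‖ ∧ ‖y‖ < 2 * (lam * (1 + ‖x‖))) := by
      simp [hSdef, ← hw, and_comm]
    simp only [indicator, mem_ofPred_eq]
    simp only [this]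
  rw [hint]
  have h2 : (lam * w) ^ d * V * (u x) ^ 2 ≤ 2 * ((3 * (lam * w)) ^ ((d : ℝ) + α) * G)
        + 2 * ∫ y in S, (u y) ^ 2 := le_trans (by gcongr) h1
  have e1 : (3 * (lam * w)) ^ ((d : ℝ) + α) =
      3 ^ ((d : ℝ) + α) * (lam ^ d * lam ^ α) * (w ^ d * w ^ α) := by
    rw [Real.mul_rpow (by norm_num) hlw.le, Real.mul_rpow hl0.le hw0.le, Real.rpow_add hl0,
      Real.rpow_add hw0, Real.rpow_natCast, Real.rpow_natCast]; ring
  have e2 : w ^ (-α - d) = (w ^ α)⁻¹ * (w ^ d)⁻¹ := by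
    rw [sub_eq_add_neg, Real.rpow_add hw0, Real.rpow_neg hw0.le, Real.rpow_neg hw0.le,
      Real.rpow_natCast]
  rw [e2, Real.rpow_neg hw0.le]
  rw [e1, mul_pow] at h2
  have hwα : 0 < w ^ α := by positivity
  have hwd : 0 < w ^ d := by positivity
  have hld : 0 < lam ^ d := by positivity
  set T := ∫ y in S, (u y) ^ 2
  have h3 := mul_le_mul_of_nonneg_left h2
    (show 0 ≤ (lam ^ d)⁻¹ * (w ^ d)⁻¹ * V⁻¹ * (w ^ α)⁻¹ by positivity)
  refine le_trans (le_of_eq ?_) (h3.trans (le_of_eq ?_))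
  · field_simp
  · field_simp

lemma hardy (d : ℕ) (α : ℝ) (hα : α ∈ Set.Ioo (0 : ℝ) 2) (hd : α < d) :
    ∃ C > (0 : ℝ), ∀ u : EuclideanSpace ℝ (Fin d) → ℝ,
      ContDiff ℝ (⊤ : ℕ∞) u → HasCompactSupport u →
      ∫ x, (u x) ^ 2 * (1 + ‖x‖) ^ (-α) ≤ C * fracD d α u := by
  have hα0 := hα.1
  have hd0 : 0 < d := by
    have : (0 : ℝ) < d := hα0.trans hd
    exact_mod_cast this
  obtain ⟨V, hV⟩ : ∃ V, V = volume.real (ball (0 : EuclideanSpace ℝ (Fin d)) 1) := ⟨_, rfl⟩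
  have hV0 : 0 < V := by
    rw [hV]; exact ENNReal.toReal_pos (measure_ball_pos _ _ one_pos).ne' measure_ball_lt_top.ne
  obtain ⟨lam, hl, hlam⟩ : ∃ lam : ℝ, 1 ≤ lam ∧
      (2 : ℝ) ^ (1 + 2 * α + d) * lam ^ (α - d) = 1 / 2 := by
    refine ⟨2 ^ ((2 + 2 * α + d) / (d - α)), Real.one_le_rpow (by norm_num) ?_, ?_⟩
    · have : 0 < (d : ℝ) - α := by linarith
      positivity
    · have : (d : ℝ) - α ≠ 0 := by linarith
      rw [← Real.rpow_mul (by norm_num), ← Real.rpow_add (by norm_num)]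
      have : 1 + 2 * α + d + (2 + 2 * α + d) / (d - α) * (α - d) = -1 := by field_simp; ring
      rw [this, Real.rpow_neg_one]; norm_num
  have hl0 : 0 < lam := by linarith
  set c1 := 2 * 3 ^ ((d : ℝ) + α) * lam ^ α / V with hc1
  have hc10 : 0 < c1 := by positivity
  refine ⟨2 * c1, by positivity, fun u hu hc => ?_⟩
  set H := ∫ x, (u x) ^ 2 * (1 + ‖x‖) ^ (-α) with hH
  have hHi := sq_weight_int d (-α) u hu.continuous hc
  have hGi := (kernel_prod d α hα hd0 u hu hc).integral_prod_left
  simp only at hGi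
  set A := {p : EuclideanSpace ℝ (Fin d) × EuclideanSpace ℝ (Fin d) |
          lam * (1 + ‖p.1‖) ≤ ‖p.2‖ ∧ ‖p.2‖ < 2 * (lam * (1 + ‖p.1‖))} with hA
  have hAm : MeasurableSet A := by
    have m1 : MeasurableSet {p : EuclideanSpace ℝ (Fin d) × EuclideanSpace ℝ (Fin d) |
        lam * (1 + ‖p.1‖) ≤ ‖p.2‖} := measurableSet_le (by fun_prop) (by fun_prop)
    have m2 : MeasurableSet {p : EuclideanSpace ℝ (Fin d) × EuclideanSpace ℝ (Fin d) |
        ‖p.2‖ < 2 * (lam * (1 + ‖p.1‖))} := measurableSet_lt (by fun_prop) (by fun_prop)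
    exact m1.inter m2
  set k : EuclideanSpace ℝ (Fin d) → EuclideanSpace ℝ (Fin d) → ℝ := fun x y =>
    (2 / (V * lam ^ d) * (1 + ‖x‖) ^ (-α - d)) * A.indicator (fun p => (u p.2) ^ 2) (x, y) with hk
  have hk0 : ∀ x y, 0 ≤ k x y := fun x y => by
    have : 0 ≤ A.indicator (fun p => (u p.2) ^ 2) (x, y) := indicator_nonneg (fun p _ => by positivity) _
    simp only [hk]; positivity
  have hkm : Measurable (Function.uncurry k) := by
    have hum := hu.continuous.measurable
    have h1 : Measurable (A.indicator (fun p => (u p.2) ^ 2)) :=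
      Measurable.indicator (by fun_prop) hAm
    simp only [hk, Function.uncurry_def]
    exact Measurable.mul (by fun_prop) h1
  have hpt := hardy_pt d α hα hd0 u hu hc lam hl V hV hV0
  have hinner : ∀ y, ∫⁻ x, ENNReal.ofReal (k x y) ≤
      ENNReal.ofReal (1 / 2 * ((u y) ^ 2 * (1 + ‖y‖) ^ (-α))) := by
    intro y
    rcases lt_or_ge ‖y‖ lam with hy | hy
    · have : ∀ x, k x y = 0 := by
        intro x
        simp only [hk]
        rw [indicator_of_notMem, mul_zero]
        intro h
        have h1 : lam * (1 + ‖x‖) ≤ ‖y‖ := h.1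
        nlinarith [norm_nonneg x]
      simp [this]
    · have hy0 : 0 < ‖y‖ := by linarith
      set c := 2 / (V * lam ^ d) * (‖y‖ / (2 * lam)) ^ (-α - d) * (u y) ^ 2 with hcdef
      have hb : ∀ x, ENNReal.ofReal (k x y) ≤
          (ball (0 : EuclideanSpace ℝ (Fin d)) (‖y‖ / lam)).indicator
            (fun _ => ENNReal.ofReal c) x := by
        intro x
        by_cases hm : (x, y) ∈ A
        · have h1 : lam * (1 + ‖x‖) ≤ ‖y‖ := hm.1
          have h2 : ‖y‖ < 2 * (lam * (1 + ‖x‖)) := hm.2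
          have hx0 := norm_nonneg x
          have hxb : x ∈ ball (0 : EuclideanSpace ℝ (Fin d)) (‖y‖ / lam) := by
            simp only [mem_ball_zero_iff]
            rw [lt_div_iff₀ hl0]; nlinarith
          rw [indicator_of_mem hxb]
          apply ENNReal.ofReal_le_ofReal
          simp only [hk, indicator_of_mem hm, hcdef]
          gcongr 2 / (V * lam ^ d) * ?_ * _
          apply Real.rpow_le_rpow_of_nonpos (by positivity)
          · rw [div_le_iff₀ (by positivity)]; nlinarith
          · have : (0 : ℝ) ≤ d := by positivity
            linarith
        · simp only [hk, indicator_of_notMem hm]; simp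
      calc ∫⁻ x, ENNReal.ofReal (k x y) ≤ ∫⁻ x, (ball (0 : EuclideanSpace ℝ (Fin d)) (‖y‖ / lam)).indicator
            (fun _ => ENNReal.ofReal c) x := lintegral_mono hb
        _ = ENNReal.ofReal c * volume (ball (0 : EuclideanSpace ℝ (Fin d)) (‖y‖ / lam)) := by
          rw [lintegral_indicator measurableSet_ball, setLIntegral_const]
        _ = ENNReal.ofReal (c * ((‖y‖ / lam) ^ d * V)) := by
          have hcn : 0 ≤ c := by positivity
          have hbv : ENNReal.ofReal ((‖y‖ / lam) ^ d * V) =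
              volume (ball (0 : EuclideanSpace ℝ (Fin d)) (‖y‖ / lam)) := by
            rw [hV, ← ball_vol d 0 (by positivity), ofReal_measureReal measure_ball_lt_top.ne]
          rw [ENNReal.ofReal_mul hcn, hbv]
        _ ≤ _ := by
          apply ENNReal.ofReal_le_ofReal
          have e0 : ‖y‖ / (2 * lam) = (‖y‖ / lam) * (1 / 2) := by field_simp
          have hz : 0 < ‖y‖ / lam := by positivity
          have e1 : (‖y‖ / (2 * lam)) ^ (-α - d) =
              (‖y‖ / lam) ^ (-α) * ((‖y‖ / lam) ^ d)⁻¹ * 2 ^ (α + d) := by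
            rw [e0, Real.mul_rpow hz.le (by norm_num), sub_eq_add_neg, Real.rpow_add hz,
              Real.rpow_neg hz.le (d : ℝ), Real.rpow_natCast, one_div, Real.inv_rpow (by norm_num),
              ← Real.rpow_neg (by norm_num)]
            congr 2; ring
          have e2 : (‖y‖ / lam) ^ (-α) = ‖y‖ ^ (-α) * lam ^ α := by
            rw [Real.div_rpow hy0.le hl0.le, Real.rpow_neg hl0.le, div_inv_eq_mul]
          have e3 : ‖y‖ ^ (-α) ≤ 2 ^ α * (1 + ‖y‖) ^ (-α) := by
            calc ‖y‖ ^ (-α) ≤ ((1 / 2) * (1 + ‖y‖)) ^ (-α) := by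
                  apply Real.rpow_le_rpow_of_nonpos (by positivity) _ (by linarith)
                  linarith
              _ = _ := by
                  rw [Real.mul_rpow (by norm_num) (by positivity), one_div,
                    Real.inv_rpow (by norm_num), ← Real.rpow_neg (by norm_num), neg_neg]
          have e4 : lam ^ (α - d) = lam ^ α * (lam ^ d)⁻¹ := by
            rw [Real.rpow_sub hl0, Real.rpow_natCast, div_eq_mul_inv]
          have e5 : (2 : ℝ) ^ (1 + 2 * α + d) = 2 * 2 ^ α * 2 ^ (α + d) := by
            rw [show 1 + 2 * α + d = 1 + α + (α + d) by ring, Real.rpow_add (by norm_num),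
              Real.rpow_add (by norm_num), Real.rpow_one]
          rw [← hlam, hcdef, e1, e2, e4, e5]
          have hzd : (‖y‖ / lam) ^ d ≠ 0 := by positivity
          calc _ = 2 * (lam ^ d)⁻¹ * lam ^ α * 2 ^ (α + d) * (u y) ^ 2 * ‖y‖ ^ (-α) := by
                generalize (‖y‖ / lam) ^ d = z at hzd
                field_simp
            _ ≤ 2 * (lam ^ d)⁻¹ * lam ^ α * 2 ^ (α + d) * (u y) ^ 2 * (2 ^ α * (1 + ‖y‖) ^ (-α)) := by
                gcongr
            _ = _ := by ring
  have hmain : ENNReal.ofReal H ≤ ENNReal.ofReal (c1 * fracD d α u + 1 / 2 * H) := by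
    have hD0 : 0 ≤ fracD d α u :=
      integral_nonneg fun x => integral_nonneg fun y => by positivity
    have hH0 : 0 ≤ H := integral_nonneg fun x => by positivity
    rw [ENNReal.ofReal_add (by positivity) (by positivity)]
    have a1 : ENNReal.ofReal H = ∫⁻ x, ENNReal.ofReal ((u x) ^ 2 * (1 + ‖x‖) ^ (-α)) :=
      ofReal_integral_eq_lintegral_ofReal hHi (ae_of_all _ fun x => by positivity)
    have a2 : ENNReal.ofReal (1 / 2 * H) =
        ∫⁻ x, ENNReal.ofReal (1 / 2 * ((u x) ^ 2 * (1 + ‖x‖) ^ (-α))) := by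
      rw [hH, ← integral_const_mul]
      exact ofReal_integral_eq_lintegral_ofReal (hHi.const_mul _) (ae_of_all _ fun x => by positivity)
    have a3 : ENNReal.ofReal (c1 * fracD d α u) =
        ∫⁻ x, ENNReal.ofReal (c1 * ∫ y, (u x - u y) ^ 2 / ‖x - y‖ ^ ((d : ℝ) + α)) := by
      rw [fracD, ← integral_const_mul]
      exact ofReal_integral_eq_lintegral_ofReal (hGi.const_mul _) (ae_of_all _ fun x =>
        mul_nonneg hc10.le (integral_nonneg fun y => by positivity))
    have a4 : ∀ x, ENNReal.ofReal (∫ y, k x y) ≤ ∫⁻ y, ENNReal.ofReal (k x y) := by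
      intro x
      rw [integral_eq_lintegral_of_nonneg_ae (ae_of_all _ (hk0 x))
        (hkm.comp (measurable_prodMk_left (x := x))).aestronglyMeasurable]
      exact ENNReal.ofReal_toReal_le
    rw [a1, a3, a2]
    calc ∫⁻ x, ENNReal.ofReal ((u x) ^ 2 * (1 + ‖x‖) ^ (-α))
        ≤ ∫⁻ x, (ENNReal.ofReal (c1 * ∫ y, (u x - u y) ^ 2 / ‖x - y‖ ^ ((d : ℝ) + α)) +
            ∫⁻ y, ENNReal.ofReal (k x y)) := by
          refine lintegral_mono fun x => ?_
          refine (ENNReal.ofReal_le_ofReal (hpt x)).trans ?_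
          exact ENNReal.ofReal_add_le.trans (add_le_add le_rfl (a4 x))
      _ = (∫⁻ x, ENNReal.ofReal (c1 * ∫ y, (u x - u y) ^ 2 / ‖x - y‖ ^ ((d : ℝ) + α))) +
            ∫⁻ x, ∫⁻ y, ENNReal.ofReal (k x y) := by
          apply lintegral_add_right
          exact Measurable.lintegral_prod_right' (f := fun p => ENNReal.ofReal (Function.uncurry k p)) hkm.ennreal_ofReal
      _ = (∫⁻ x, ENNReal.ofReal (c1 * ∫ y, (u x - u y) ^ 2 / ‖x - y‖ ^ ((d : ℝ) + α))) +
            ∫⁻ y, ∫⁻ x, ENNReal.ofReal (k x y) := by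
          congr 1
          exact lintegral_lintegral_swap (f := fun x y => ENNReal.ofReal (k x y))
            hkm.ennreal_ofReal.aemeasurable
      _ ≤ _ := by
          gcongr with y
          exact hinner y
  have hD0 : 0 ≤ fracD d α u :=
    integral_nonneg fun x => integral_nonneg fun y => by positivity
  have hH0 : 0 ≤ H := integral_nonneg fun x => by positivity
  rw [ENNReal.ofReal_le_ofReal_iff (by positivity)] at hmain
  linarith

set_option maxHeartbeats 1000000 in
lemma nash_pt (d : ℕ) (α β : ℝ) (hα : α ∈ Set.Ioo (0 : ℝ) 2) (hd : α < d)
    (hβ₁ : α < β) (hβ₂ : β < 2 * α)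
    (θ : ℝ) (hθ : θ = α * ((d : ℝ) + β - 2 * α) / (β - α))
    (u : EuclideanSpace ℝ (Fin d) → ℝ)
    (hu : ContDiff ℝ (⊤ : ℕ∞) u) (hc : HasCompactSupport u) (V : ℝ)
    (hV : V = volume.real (ball (0 : EuclideanSpace ℝ (Fin d)) 1)) (hV0 : 0 < V)
    (t : ℝ) (ht : 0 < t) (γ : ℝ) (hγ : γ = d + β - α)
    (M : ℝ) (hM : M = ∫ y, |u y| * (1 + ‖y‖) ^ (-γ))
    (x : EuclideanSpace ℝ (Fin d)) :
    (u x) ^ 2 * (1 + ‖x‖) ^ (-β) ≤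
      t * ((u x) ^ 2 * (1 + ‖x‖) ^ (-α)) +
      (V⁻¹ * t) * (∫ y, (u x - u y) ^ 2 / ‖x - y‖ ^ ((d : ℝ) + α)) +
      (V⁻¹ * (2 * 2 ^ γ * 2 ^ d) * t ^ (-(θ / α)) * M) * (|u x| * (1 + ‖x‖) ^ (-γ)) := by
  have hα0 := hα.1
  have hdr : (0 : ℝ) < d := hα0.trans hd
  have hd0 : 0 < d := by exact_mod_cast hdr
  have hγ0 : 0 < γ := by rw [hγ]; linarith
  set w := 1 + ‖x‖ with hw
  have hx0 := norm_nonneg x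
  have hw1 : 1 ≤ w := by linarith
  have hw0 : 0 < w := by linarith
  have hG0 : 0 ≤ ∫ y, (u x - u y) ^ 2 / ‖x - y‖ ^ ((d : ℝ) + α) :=
    integral_nonneg fun y => by positivity
  have hM0 : 0 ≤ M := by rw [hM]; exact integral_nonneg fun y => by positivity
  rcases le_or_gt (w ^ (-β)) (t * w ^ (-α)) with h | h
  · have : (u x) ^ 2 * w ^ (-β) ≤ t * ((u x) ^ 2 * w ^ (-α)) := by
      calc (u x) ^ 2 * w ^ (-β) ≤ (u x) ^ 2 * (t * w ^ (-α)) := by gcongr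
        _ = _ := by ring
    have h2 : 0 ≤ (V⁻¹ * t) * (∫ y, (u x - u y) ^ 2 / ‖x - y‖ ^ ((d : ℝ) + α)) :=
      mul_nonneg (mul_nonneg (inv_nonneg.2 hV0.le) ht.le) hG0
    have h3 : 0 ≤ (V⁻¹ * (2 * 2 ^ γ * 2 ^ d) * t ^ (-(θ / α)) * M) * (|u x| * w ^ (-γ)) := by
      positivity
    linarith
  · have hwα : 0 < w ^ α := by positivity
    have hwβ : 0 < w ^ β := by positivity
    set q := t * w ^ β with hq
    have hq0 : 0 < q := by positivity
    have hqw : q < w ^ α := by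
      rw [Real.rpow_neg hw0.le, Real.rpow_neg hw0.le, ← div_eq_mul_inv, ← one_div,
        div_lt_div_iff₀ hwα hwβ] at h
      linarith
    set ρ := q ^ (1 / α) with hρ
    have hρ0 : 0 < ρ := by positivity
    have hρα : ρ ^ α = q := by
      rw [hρ, ← Real.rpow_mul hq0.le]; field_simp; simp
    have hρw : ρ < w := by
      rw [← hρα] at hqw
      exact (Real.rpow_lt_rpow_iff hρ0.le hw0.le hα0).1 hqw
    set r := ρ / 2 with hr
    have hr0 : 0 < r := by positivity
    have h1 := (sq_le_avg d α hα hd0 u hu hc x (ball x r) measurableSet_ball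
      measure_ball_lt_top.ne r hr0 (by
        intro y hy
        rw [mem_ball, dist_comm, dist_eq_norm] at hy; exact hy.le)).2
    rw [ball_vol d x hr0, ← hV] at h1
    generalize (∫ y, (u x - u y) ^ 2 / ‖x - y‖ ^ ((d : ℝ) + α)) = G at *
    have hBM : ∫ y in ball x r, |u y| ≤ (2 * w) ^ γ * M := by
      have hMi := (abs_weight_int d (-γ) u hu.continuous hc).const_mul ((2 * w) ^ γ)
      calc ∫ y in ball x r, |u y|
          ≤ ∫ y in ball x r, (2 * w) ^ γ * (|u y| * (1 + ‖y‖) ^ (-γ)) := by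
            refine integral_mono_of_nonneg (ae_of_all _ fun y => abs_nonneg _) hMi.integrableOn ?_
            refine (ae_restrict_mem measurableSet_ball).mono fun y hy => ?_
            have hy1 : 1 + ‖y‖ ≤ 2 * w := by
              rw [mem_ball, dist_eq_norm] at hy
              have := norm_sub_norm_le y x
              linarith
            have hy0 : 0 < 1 + ‖y‖ := by positivity
            have : (1 + ‖y‖) ^ γ ≤ (2 * w) ^ γ := Real.rpow_le_rpow hy0.le hy1 hγ0.le
            have hp : 0 < (1 + ‖y‖) ^ γ := by positivity
            simp only
            rw [Real.rpow_neg hy0.le]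
            calc |u y| = (1 + ‖y‖) ^ γ * (|u y| * ((1 + ‖y‖) ^ γ)⁻¹) := by field_simp
              _ ≤ _ := by gcongr
        _ ≤ ∫ y, (2 * w) ^ γ * (|u y| * (1 + ‖y‖) ^ (-γ)) :=
            setIntegral_le_integral hMi (ae_of_all _ fun y => by positivity)
        _ = _ := by rw [integral_const_mul, hM]
    have hrα : r ^ α ≤ q := by
      rw [← hρα]; exact Real.rpow_le_rpow hr0.le (by linarith) hα0.le
    have hrd0 : 0 < r ^ d := by positivity
    have hrd : (r ^ d)⁻¹ = 2 ^ d * q ^ (-(d / α)) := by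
      rw [hr, div_pow, inv_div, div_eq_mul_inv, hρ, ← Real.rpow_natCast (q ^ (1 / α)) d,
        ← Real.rpow_mul hq0.le, ← Real.rpow_neg hq0.le]
      congr 3; ring
    have h2 : V * (u x) ^ 2 ≤ q * G + 2 * |u x| * (2 ^ d * q ^ (-(d / α))) * ((2 * w) ^ γ * M) := by
      have h3 : r ^ d * V * (u x) ^ 2 ≤
          r ^ d * (q * G) + 2 * |u x| * ((2 * w) ^ γ * M) := by
        refine h1.trans ?_
        rw [Real.rpow_add hr0, Real.rpow_natCast, mul_assoc (r ^ d)]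
        gcongr
      have h4 := mul_le_mul_of_nonneg_left h3 (inv_nonneg.2 hrd0.le)
      rw [← hrd]
      refine le_trans (le_of_eq ?_) (h4.trans (le_of_eq ?_))
      · field_simp
      · field_simp
    have hqw' : q * w ^ (-β) = t := by
      rw [hq, Real.rpow_neg hw0.le]; field_simp
    have hba : 0 < β - α := by linarith
    set e := (2 * α - β) * (d - α) / α with he
    have he0 : 0 ≤ e := by
      have : 0 ≤ 2 * α - β := by linarith
      have : 0 ≤ d - α := by linarith
      positivity
    have hwt : w ^ e ≤ t ^ (-(e / (β - α))) := by
      have a1 : w ^ (β - α) ≤ t⁻¹ := by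
        rw [Real.rpow_sub hw0, div_le_iff₀ hwα, inv_mul_eq_div, le_div_iff₀ ht, mul_comm]
        exact hqw.le
      calc w ^ e = (w ^ (β - α)) ^ (e / (β - α)) := by
            rw [← Real.rpow_mul hw0.le]; congr 1; field_simp
        _ ≤ (t⁻¹) ^ (e / (β - α)) := Real.rpow_le_rpow (by positivity) a1 (by positivity)
        _ = _ := by rw [Real.inv_rpow ht.le, Real.rpow_neg ht.le]
    have hkey : q ^ (-(d / α)) * w ^ γ * w ^ (-β) ≤ t ^ (-(θ / α)) * w ^ (-γ) := by
      have b1 : q ^ (-(d / α)) * w ^ γ * w ^ (-β) = t ^ (-(d / α)) * w ^ e * w ^ (-γ) := by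
        rw [hq, Real.mul_rpow ht.le hwβ.le, ← Real.rpow_mul hw0.le]
        rw [mul_assoc, mul_assoc, mul_assoc, ← Real.rpow_add hw0, ← Real.rpow_add hw0,
          ← Real.rpow_add hw0]
        congr 2
        rw [he, hγ]; field_simp; ring
      have b2 : t ^ (-(θ / α)) = t ^ (-(d / α)) * t ^ (-(e / (β - α))) := by
        rw [← Real.rpow_add ht]; congr 1
        have := hba.ne'
        rw [he, hθ]; field_simp; ring
      rw [b1, b2]
      gcongr
    have h0 : 0 ≤ t * ((u x) ^ 2 * w ^ (-α)) := by positivity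
    have h5 := mul_le_mul_of_nonneg_left h2 (show 0 ≤ V⁻¹ * w ^ (-β) by positivity)
    have h6 : V⁻¹ * w ^ (-β) * (V * (u x) ^ 2) = (u x) ^ 2 * w ^ (-β) := by field_simp
    rw [h6] at h5
    have h7 : V⁻¹ * w ^ (-β) * (q * G + 2 * |u x| * (2 ^ d * q ^ (-(d / α))) * ((2 * w) ^ γ * M))
        = V⁻¹ * t * G + (V⁻¹ * (2 * 2 ^ γ * 2 ^ d) * M * |u x|) *
          (q ^ (-(d / α)) * w ^ γ * w ^ (-β)) := by
      rw [Real.mul_rpow (by norm_num) hw0.le, ← hqw']; ring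
    rw [h7] at h5
    have h8 : (V⁻¹ * (2 * 2 ^ γ * 2 ^ d) * M * |u x|) * (q ^ (-(d / α)) * w ^ γ * w ^ (-β)) ≤
        (V⁻¹ * (2 * 2 ^ γ * 2 ^ d) * M * |u x|) * (t ^ (-(θ / α)) * w ^ (-γ)) := by gcongr
    have h9 : (V⁻¹ * (2 * 2 ^ γ * 2 ^ d) * M * |u x|) * (t ^ (-(θ / α)) * w ^ (-γ)) =
        (V⁻¹ * (2 * 2 ^ γ * 2 ^ d) * t ^ (-(θ / α)) * M) * (|u x| * w ^ (-γ)) := by ring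
    linarith

theorem weighted_nash_inequality_small_beta
    (d : ℕ) (α β : ℝ) (hα : α ∈ Set.Ioo (0 : ℝ) 2) (hd : α < d)
    (hβ₁ : α < β) (hβ₂ : β < 2 * α)
    (θ : ℝ) (hθ : θ = α * ((d : ℝ) + β - 2 * α) / (β - α)) :
    ∃ C > (0 : ℝ), ∀ u : EuclideanSpace ℝ (Fin d) → ℝ,
      ContDiff ℝ (⊤ : ℕ∞) u → HasCompactSupport u →
        (∫ x, (u x) ^ 2 * (1 + ‖x‖) ^ (-β)) ^ ((θ + α) / θ) ≤
          C * fracD d α u *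
            (∫ x, |u x| * (1 + ‖x‖) ^ (α - (d : ℝ)) * (1 + ‖x‖) ^ (-β))
              ^ (2 * α / θ) := by
  have hα0 := hα.1
  have hdr : (0 : ℝ) < d := hα0.trans hd
  have hd0 : 0 < d := by exact_mod_cast hdr
  have hθ0 : 0 < θ := by
    have h1 : 0 < (d : ℝ) + β - 2 * α := by linarith
    have h2 : 0 < β - α := by linarith
    rw [hθ]; positivity
  obtain ⟨V, hV⟩ : ∃ V, V = volume.real (ball (0 : EuclideanSpace ℝ (Fin d)) 1) := ⟨_, rfl⟩
  have hV0 : 0 < V := by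
    rw [hV]; exact ENNReal.toReal_pos (measure_ball_pos _ _ one_pos).ne' measure_ball_lt_top.ne
  obtain ⟨CH, hCH, hH⟩ := hardy d α hα hd
  obtain ⟨γ, hγ⟩ : ∃ γ : ℝ, γ = d + β - α := ⟨_, rfl⟩
  set C := CH + V⁻¹ + V⁻¹ * (2 * 2 ^ γ * 2 ^ d) with hCdef
  have hC0 : 0 < C := by positivity
  refine ⟨2 * C * (2 * C) ^ (α / θ), by positivity, fun u hu hc => ?_⟩
  have hMe : (∫ x, |u x| * (1 + ‖x‖) ^ (α - (d : ℝ)) * (1 + ‖x‖) ^ (-β)) =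
      ∫ y, |u y| * (1 + ‖y‖) ^ (-γ) := by
    congr 1; ext x
    rw [mul_assoc, ← Real.rpow_add (by positivity), hγ]
    congr 2; ring
  rw [hMe]
  obtain ⟨M, hM⟩ : ∃ M, M = ∫ y, |u y| * (1 + ‖y‖) ^ (-γ) := ⟨_, rfl⟩
  rw [← hM]
  have hM0 : 0 ≤ M := by rw [hM]; exact integral_nonneg fun y => by positivity
  have hD0 : 0 ≤ fracD d α u :=
    integral_nonneg fun x => integral_nonneg fun y => by positivity
  refine final_step α θ C _ _ _ hα0 hθ0 hC0 (integral_nonneg fun x => by positivity) hD0 hM0 ?_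
  intro t ht
  have hpt := nash_pt d α β hα hd hβ₁ hβ₂ θ hθ u hu hc V hV hV0 t ht γ hγ M hM
  have hGi := (kernel_prod d α hα hd0 u hu hc).integral_prod_left
  simp only at hGi
  have i1 := (sq_weight_int d (-α) u hu.continuous hc).const_mul t
  have i2 := hGi.const_mul (V⁻¹ * t)
  have i3 := (abs_weight_int d (-γ) u hu.continuous hc).const_mul
    (V⁻¹ * (2 * 2 ^ γ * 2 ^ d) * t ^ (-(θ / α)) * M)
  have hint := integral_mono (sq_weight_int d (-β) u hu.continuous hc) ((i1.add i2).add i3) hpt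
  have hsum := integral_add (i1.add i2) i3
  have hsum2 := integral_add i1 i2
  simp only [Pi.add_apply] at hint hsum hsum2
  rw [hsum, hsum2, integral_const_mul, integral_const_mul, integral_const_mul, ← hM] at hint
  change _ ≤ t * _ + V⁻¹ * t * fracD d α u + _ at hint
  have hHu := mul_le_mul_of_nonneg_left (hH u hu hc) ht.le
  have p1 : 0 ≤ t * fracD d α u := by positivity
  have p2 : 0 ≤ t ^ (-(θ / α)) * M ^ 2 := by positivity
  have p3 : 0 ≤ V⁻¹ * (2 * 2 ^ γ * 2 ^ d) := by positivity
  have p4 : 0 < V⁻¹ := by positivity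
  have f1 := mul_nonneg p3 p1
  have f2 := mul_nonneg hCH.le p2
  have f3 := mul_nonneg p4.le p2
  have : C * (t * fracD d α u + t ^ (-(θ / α)) * M ^ 2) =
    t * (CH * fracD d α u) + V⁻¹ * t * fracD d α u +
      V⁻¹ * (2 * 2 ^ γ * 2 ^ d) * t ^ (-(θ / α)) * M * M +
      (V⁻¹ * (2 * 2 ^ γ * 2 ^ d) * (t * fracD d α u) + CH * (t ^ (-(θ / α)) * M ^ 2) +
        V⁻¹ * (t ^ (-(θ / α)) * M ^ 2)) := by
    rw [hCdef]; ring
  linarith
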